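/- arXiv:1809.02703 — 4 statements merged into one kernel-verified Lean document; each statement's English description precedes it below -/
import Mathlib

section
/- In any state τ ∈ Ω, a green cross and a red cross cannot coexist; that is, C_G ∩ C_R = ∅. -/
open Finset

/-! Six-vertex model on the `n × n` square lattice region `Λ_n` with free
boundary conditions.

`Edge.horiz k j` is the horizontal edge between `x = k-1` and `x = k` at
height `j`; `Edge.vert i k` is the vertical edge between `y = k-1` and
`y = k` on column `i`.  The vertices of `Λ_n` are the pairs
`(i, j) : Fin n × Fin n`.  An edge configuration assigns `true`
(rightwards / upwards) or `false` (leftwards / downwards) to every edge. -/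
inductive Edge (n : ℕ) : Type
  | horiz (k : Fin (n + 1)) (j : Fin n) : Edge n
  | vert (i : Fin n) (k : Fin (n + 1)) : Edge n
  deriving DecidableEq, Fintype

abbrev EdgeConfig (n : ℕ) := Edge n → Bool

/-- The four edges incident to the vertex `(i, j)` of `Λ_n`. -/
def leftE {n : ℕ} (i j : Fin n) : Edge n := Edge.horiz i.castSucc j
def rightE {n : ℕ} (i j : Fin n) : Edge n := Edge.horiz i.succ j
def botE {n : ℕ} (i j : Fin n) : Edge n := Edge.vert i j.castSucc
def topE {n : ℕ} (i j : Fin n) : Edge n := Edge.vert i j.succ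

/-- The in-degree of the vertex `(i, j)` in the configuration `τ`. -/
def inDegree {n : ℕ} (τ : EdgeConfig n) (i j : Fin n) : ℕ :=
  (cond (τ (leftE i j)) 1 0) + (cond (τ (rightE i j)) 0 1) +
    (cond (τ (botE i j)) 1 0) + (cond (τ (topE i j)) 0 1)

/-- The ice rule: every vertex has exactly two incoming (and hence two
outgoing) incident edges; such a configuration is an Eulerian orientation. -/
def IceRule {n : ℕ} (τ : EdgeConfig n) : Prop :=
  ∀ i j : Fin n, inDegree τ i j = 2

instance {n : ℕ} (τ : EdgeConfig n) : Decidable (IceRule τ) :=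
  inferInstanceAs (Decidable (∀ i j : Fin n, inDegree τ i j = 2))

/-- `Ω`, the state space: all Eulerian orientations of `Λ_n`. -/
def OmegaSet (n : ℕ) : Set (EdgeConfig n) := {τ | IceRule τ}

/-- The state `τ_G`, in which every vertex has six-vertex type `c`. -/
def greenOrient {n : ℕ} : Edge n → Bool
  | Edge.horiz k j => (k.val + j.val) % 2 == 0
  | Edge.vert i k => (i.val + k.val) % 2 == 1

def tauG (n : ℕ) : EdgeConfig n := greenOrient

/-- The state `τ_R`, the total edge reversal of `τ_G`. -/
def tauR (n : ℕ) : EdgeConfig n := fun e => !(greenOrient e)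

/-- An edge is green in `τ` if it is oriented as in `τ_G`, red otherwise. -/
def greenB {n : ℕ} (τ : EdgeConfig n) (e : Edge n) : Bool := τ e == greenOrient e

def IsGreen {n : ℕ} (τ : EdgeConfig n) (e : Edge n) : Prop := τ e = greenOrient e
def IsRed {n : ℕ} (τ : EdgeConfig n) (e : Edge n) : Prop := τ e = !(greenOrient e)

/-- Incidence between edges and vertices of `Λ_n`. -/
def EdgeIncident {n : ℕ} : Edge n → Fin n × Fin n → Prop
  | Edge.horiz k j', (i, j) => j' = j ∧ (k = i.castSucc ∨ k = i.succ)
  | Edge.vert i' k, (i, j) => i' = i ∧ (k = j.castSucc ∨ k = j.succ)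

/-- Two (distinct) edges are adjacent if they share an incident `Λ_n`-vertex. -/
def EdgeAdj {n : ℕ} (e f : Edge n) : Prop :=
  e ≠ f ∧ ∃ v : Fin n × Fin n, EdgeIncident e v ∧ EdgeIncident f v

/-- A simple (self-avoiding) monochromatic path of edges of colour `g`
(`true` = green, `false` = red). -/
def MonoPath {n : ℕ} (τ : EdgeConfig n) (g : Bool) (p : List (Edge n)) : Prop :=
  p ≠ [] ∧ p.Nodup ∧ List.Chain' EdgeAdj p ∧ ∀ e ∈ p, greenB τ e = g

/-- A horizontal monochromatic bridge: a simple monochromatic path from a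
horizontal edge on the left boundary to a horizontal edge on the right
boundary of `Λ_n`. -/
def IsHorizBridge {n : ℕ} (τ : EdgeConfig n) (g : Bool) (p : List (Edge n)) : Prop :=
  MonoPath τ g p ∧ (∃ j, p.head? = some (Edge.horiz 0 j)) ∧
    (∃ j, p.getLast? = some (Edge.horiz (Fin.last n) j))

/-- A vertical monochromatic bridge, from the top boundary to the bottom. -/
def IsVertBridge {n : ℕ} (τ : EdgeConfig n) (g : Bool) (p : List (Edge n)) : Prop :=
  MonoPath τ g p ∧ (∃ i, p.head? = some (Edge.vert i (Fin.last n))) ∧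
    (∃ i, p.getLast? = some (Edge.vert i 0))

def HorizGreenBridge {n : ℕ} (τ : EdgeConfig n) : Prop := ∃ p, IsHorizBridge τ true p
def HorizRedBridge {n : ℕ} (τ : EdgeConfig n) : Prop := ∃ p, IsHorizBridge τ false p
def VertGreenBridge {n : ℕ} (τ : EdgeConfig n) : Prop := ∃ p, IsVertBridge τ true p
def VertRedBridge {n : ℕ} (τ : EdgeConfig n) : Prop := ∃ p, IsVertBridge τ false p

def HasGreenCross {n : ℕ} (τ : EdgeConfig n) : Prop :=
  HorizGreenBridge τ ∧ VertGreenBridge τ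

def HasRedCross {n : ℕ} (τ : EdgeConfig n) : Prop :=
  HorizRedBridge τ ∧ VertRedBridge τ

/-- `C_G`: the states with a green cross. -/
def CG (n : ℕ) : Set (EdgeConfig n) := {τ | IceRule τ ∧ HasGreenCross τ}

/-- `C_R`: the states with a red cross. -/
def CR (n : ℕ) : Set (EdgeConfig n) := {τ | IceRule τ ∧ HasRedCross τ}

/-! The shifted lattice `L = ℤ² + (1/2, 1/2)`, restricted to the region inside
`Λ_n`.  The `L_n`-vertex `(i, j) : Fin (n+1) × Fin (n+1)` represents the point
`(i - 1/2, j - 1/2)`; its boundary vertices are those with a coordinate equal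
to `0` or `n`.  An `L_n`-edge is a diagonal passing through exactly one
`Λ_n`-vertex; it is recorded as that `Λ_n`-vertex together with a Boolean
(`true` for the NE–SW diagonal, `false` for the NW–SE diagonal). -/
abbrev LVertex (n : ℕ) := Fin (n + 1) × Fin (n + 1)

abbrev LEdge (n : ℕ) := (Fin n × Fin n) × Bool

/-- The two `L_n`-endpoints of an `L_n`-edge. -/
def lEdgeEnds {n : ℕ} : LEdge n → LVertex n × LVertex n
  | ((i, j), true) => ((i.castSucc, j.castSucc), (i.succ, j.succ))
  | ((i, j), false) => ((i.succ, j.castSucc), (i.castSucc, j.succ))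

/-- The `L_n`-edge `e` joins the `L_n`-vertices `u` and `v`. -/
def StepOnEdge {n : ℕ} (e : LEdge n) (u v : LVertex n) : Prop :=
  lEdgeEnds e = (u, v) ∨ lEdgeEnds e = (v, u)

/-- Adjacency in the lattice `L_n`. -/
def LAdjacent {n : ℕ} (u v : LVertex n) : Prop :=
  ∃ e : LEdge n, StepOnEdge e u v

/-- Membership of an `L_n`-edge in `L_τ`: the four `Λ_n`-edges incident to the
`Λ_n`-vertex it passes through are two green and two red, and the edge
separates the two green edges from the two red ones. -/
def lTau {n : ℕ} (τ : EdgeConfig n) : LEdge n → Bool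
  | ((i, j), true) =>
      (greenB τ (leftE i j) == greenB τ (topE i j)) &&
        (greenB τ (rightE i j) == greenB τ (botE i j)) &&
        !(greenB τ (leftE i j) == greenB τ (rightE i j))
  | ((i, j), false) =>
      (greenB τ (leftE i j) == greenB τ (botE i j)) &&
        (greenB τ (rightE i j) == greenB τ (topE i j)) &&
        !(greenB τ (leftE i j) == greenB τ (rightE i j))

/-- A step between two `L_n`-vertices along an edge of `L_τ`. -/
def LStep {n : ℕ} (τ : EdgeConfig n) (u v : LVertex n) : Prop :=
  ∃ e : LEdge n, StepOnEdge e u v ∧ lTau τ e = true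

/-- The consecutive steps of a path given as a list of vertices. -/
def pathSteps {α : Type*} (p : List α) : List (α × α) := p.zip p.tail

/-- A vertical fault line: a self-avoiding path of `L_τ`-edges from an
`L_n`-vertex on the top boundary to an `L_n`-vertex on the bottom boundary. -/
def IsVertFaultLine {n : ℕ} (τ : EdgeConfig n) (p : List (LVertex n)) : Prop :=
  p ≠ [] ∧ p.Nodup ∧ List.Chain' (LStep τ) p ∧
    (∃ u, p.head? = some u ∧ u.2 = Fin.last n) ∧
    (∃ u, p.getLast? = some u ∧ u.2 = 0)

/-- A horizontal fault line: from the left boundary to the right boundary. -/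
def IsHorizFaultLine {n : ℕ} (τ : EdgeConfig n) (p : List (LVertex n)) : Prop :=
  p ≠ [] ∧ p.Nodup ∧ List.Chain' (LStep τ) p ∧
    (∃ u, p.head? = some u ∧ u.1 = 0) ∧
    (∃ u, p.getLast? = some u ∧ u.1 = Fin.last n)

def HasVertFaultLine {n : ℕ} (τ : EdgeConfig n) : Prop := ∃ p, IsVertFaultLine τ p
def HasHorizFaultLine {n : ℕ} (τ : EdgeConfig n) : Prop := ∃ p, IsHorizFaultLine τ p

/-- `C_FL`: the states with a (horizontal or vertical) fault line. -/
def CFL (n : ℕ) : Set (EdgeConfig n) :=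
  {τ | IceRule τ ∧ (HasHorizFaultLine τ ∨ HasVertFaultLine τ)}

/-- A vertical almost fault line: a self-avoiding `L_n`-path from the top
boundary to the bottom boundary all of whose edges except exactly one
belong to `L_τ`. -/
def IsVertAlmostFaultLine {n : ℕ} (τ : EdgeConfig n) (p : List (LVertex n)) : Prop :=
  p ≠ [] ∧ p.Nodup ∧ List.Chain' LAdjacent p ∧
    (∃ u, p.head? = some u ∧ u.2 = Fin.last n) ∧
    (∃ u, p.getLast? = some u ∧ u.2 = 0) ∧
    ∃ s ∈ pathSteps p, ¬ LStep τ s.1 s.2 ∧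
      ∀ t ∈ pathSteps p, t ≠ s → LStep τ t.1 t.2

/-- A horizontal almost fault line. -/
def IsHorizAlmostFaultLine {n : ℕ} (τ : EdgeConfig n) (p : List (LVertex n)) : Prop :=
  p ≠ [] ∧ p.Nodup ∧ List.Chain' LAdjacent p ∧
    (∃ u, p.head? = some u ∧ u.1 = 0) ∧
    (∃ u, p.getLast? = some u ∧ u.1 = Fin.last n) ∧
    ∃ s ∈ pathSteps p, ¬ LStep τ s.1 s.2 ∧
      ∀ t ∈ pathSteps p, t ≠ s → LStep τ t.1 t.2

/-- `C_AFL`: the states with an almost fault line. -/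
def CAFL (n : ℕ) : Set (EdgeConfig n) :=
  {τ | IceRule τ ∧
    ((∃ p, IsHorizAlmostFaultLine τ p) ∨ (∃ p, IsVertAlmostFaultLine τ p))}

/-- The weight of the vertex `(i, j)`: `c` for the two `c`-type configurations
(both horizontal edges in, or both out), and `a` or `b` for the others. -/
noncomputable def vertexWeight {n : ℕ} (a b c : ℝ) (τ : EdgeConfig n)
    (i j : Fin n) : ℝ :=
  if τ (leftE i j) ≠ τ (rightE i j) then c
  else if τ (leftE i j) = τ (botE i j) then a else b

/-- The weight `w(τ)` of a state: the product of the vertex weights. -/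
noncomputable def weight {n : ℕ} (a b c : ℝ) (τ : EdgeConfig n) : ℝ :=
  ∏ v : Fin n × Fin n, vertexWeight a b c τ v.1 v.2

/-- The partition function `Z`. -/
noncomputable def Zsum (n : ℕ) (a b c : ℝ) : ℝ :=
  ∑ τ ∈ Finset.univ.filter (fun τ : EdgeConfig n => IceRule τ), weight a b c τ

open Classical in
/-- The Gibbs measure of a set of states, `π(S) = (Σ_{τ∈S} w(τ))/Z`. -/
noncomputable def piSet (n : ℕ) (a b c : ℝ) (S : Set (EdgeConfig n)) : ℝ :=
  (∑ τ ∈ Finset.univ.filter (fun τ : EdgeConfig n => τ ∈ S), weight a b c τ) /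
    Zsum n a b c

/-- The four edges (bottom, right, top, left) of the unit square of `ℤ²`
whose lower-left corner is the `Λ_n`-vertex `(i, j)`. -/
def squareEdges (n : ℕ) (i j : ℕ) (hi : i + 1 < n) (hj : j + 1 < n) :
    Edge n × Edge n × Edge n × Edge n :=
  (Edge.horiz ⟨i + 1, by omega⟩ ⟨j, by omega⟩,
    Edge.vert ⟨i + 1, by omega⟩ ⟨j + 1, by omega⟩,
    Edge.horiz ⟨i + 1, by omega⟩ ⟨j + 1, by omega⟩,
    Edge.vert ⟨i, by omega⟩ ⟨j + 1, by omega⟩)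

/-- The four edges (bottom, right, top, left) around a unit square form a
directed cycle, i.e. are consistently oriented. -/
def DirectedSquare {n : ℕ} (τ : EdgeConfig n)
    (e : Edge n × Edge n × Edge n × Edge n) : Prop :=
  (τ e.1 = true ∧ τ e.2.1 = true ∧ τ e.2.2.1 = false ∧ τ e.2.2.2 = false) ∨
    (τ e.1 = false ∧ τ e.2.1 = false ∧ τ e.2.2.1 = true ∧ τ e.2.2.2 = true)

/-- Reversing the orientations of the four edges around a unit square. -/
def flipSquare {n : ℕ} (τ : EdgeConfig n)
    (e : Edge n × Edge n × Edge n × Edge n) : EdgeConfig n :=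
  fun f => if f = e.1 ∨ f = e.2.1 ∨ f = e.2.2.1 ∨ f = e.2.2.2 then !(τ f) else τ f

/-- A move of the Glauber dynamics `M_G` at the unit square with lower-left
corner `(i, j)`: the four edges around the square are consistently oriented
in `τ`, and `τ'` is obtained from `τ` by reversing them. -/
def GlauberMoveAt {n : ℕ} (τ τ' : EdgeConfig n) (i j : ℕ)
    (hi : i + 1 < n) (hj : j + 1 < n) : Prop :=
  DirectedSquare τ (squareEdges n i j hi hj) ∧
    τ' = flipSquare τ (squareEdges n i j hi hj)

/-- A move of the Glauber dynamics `M_G`. -/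
def GlauberMove {n : ℕ} (τ τ' : EdgeConfig n) : Prop :=
  ∃ (i j : ℕ) (hi : i + 1 < n) (hj : j + 1 < n), GlauberMoveAt τ τ' i j hi hj

/-- `∂C_G`: the states outside `C_G` that are one move of `M_G` away from
`C_G`. -/
def boundaryCG (n : ℕ) : Set (EdgeConfig n) :=
  {τ | IceRule τ ∧ τ ∉ CG n ∧ ∃ σ ∈ CG n, GlauberMove σ τ}

/-- The state space `Ω` as a type. -/
abbrev OmegaT (n : ℕ) := {τ : EdgeConfig n // IceRule τ}

open Classical in
/-- Metropolis transition rate of `M_G` between two distinct states: propose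
one of the `(n-1)²` unit squares uniformly at random and accept the flip with
probability `min 1 (w(τ')/w(τ))`. -/
noncomputable def metro {n : ℕ} (a b c : ℝ) (τ τ' : OmegaT n) : ℝ :=
  if GlauberMove τ.1 τ'.1 then
    (1 / (((n : ℝ) - 1) * ((n : ℝ) - 1))) *
      min 1 (weight a b c τ'.1 / weight a b c τ.1)
  else 0

/-- The transition matrix of the Glauber dynamics `M_G`. -/
noncomputable def transP {n : ℕ} (a b c : ℝ) (τ τ' : OmegaT n) : ℝ :=
  if τ' = τ then 1 - ∑ σ ∈ Finset.univ.erase τ, metro a b c τ σ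
  else metro a b c τ τ'

/-- The `t`-step transition probabilities of `M_G`. -/
noncomputable def transPow {n : ℕ} (a b c : ℝ) : ℕ → OmegaT n → OmegaT n → ℝ
  | 0, τ, τ' => if τ = τ' then 1 else 0
  | t + 1, τ, τ' => ∑ σ : OmegaT n, transPow a b c t τ σ * transP a b c σ τ'

/-- The stationary Gibbs distribution `π` on `Ω`. -/
noncomputable def piDist {n : ℕ} (a b c : ℝ) (τ : OmegaT n) : ℝ :=
  weight a b c τ.1 / Zsum n a b c

/-- Total variation distance between two distributions on `Ω`. -/
noncomputable def tvDist {n : ℕ} (μ ν : OmegaT n → ℝ) : ℝ :=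
  (∑ τ : OmegaT n, |μ τ - ν τ|) / 2

/-- The mixing time of `M_G`: the smallest `t` after which the total variation
distance to `π` is at most `1/4` from any starting state. -/
noncomputable def mixingTime (n : ℕ) (a b c : ℝ) : ℕ :=
  sInf {t : ℕ | ∀ τ₀ : OmegaT n,
    tvDist (transPow a b c t τ₀) (piDist a b c) ≤ 1 / 4}

/-- The number of green edges incident to the vertex `(i, j)` in `τ`. -/
def greenCountAt {n : ℕ} (τ : EdgeConfig n) (i j : Fin n) : ℕ :=
  (cond (greenB τ (leftE i j)) 1 0) + (cond (greenB τ (rightE i j)) 1 0) +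
    (cond (greenB τ (botE i j)) 1 0) + (cond (greenB τ (topE i j)) 1 0)

/-- The number of `L_τ`-edges incident to the `L_n`-vertex `u`. -/
def lTauDegree {n : ℕ} (τ : EdgeConfig n) (u : LVertex n) : ℕ :=
  (Finset.univ.filter (fun e : LEdge n =>
    lTau τ e = true ∧ ((lEdgeEnds e).1 = u ∨ (lEdgeEnds e).2 = u))).card

/-- The number of colour changes encountered when going rotationally
(bottom, right, top, left) around the four `Λ_n`-edges surrounding the
internal `L_n`-vertex `(i, j)` (representing the point `(i - 1/2, j - 1/2)`). -/
def colorChangesAround (n : ℕ) (τ : EdgeConfig n) (i j : ℕ)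
    (hi0 : 0 < i) (hin : i < n) (hj0 : 0 < j) (hjn : j < n) : ℕ :=
  let bo := greenB τ (Edge.horiz ⟨i, by omega⟩ ⟨j - 1, by omega⟩)
  let t := greenB τ (Edge.horiz ⟨i, by omega⟩ ⟨j, by omega⟩)
  let l := greenB τ (Edge.vert ⟨i - 1, by omega⟩ ⟨j, by omega⟩)
  let r := greenB τ (Edge.vert ⟨i, by omega⟩ ⟨j, by omega⟩)
  (cond (bo != r) 1 0) + (cond (r != t) 1 0) +
    (cond (t != l) 1 0) + (cond (l != bo) 1 0)

/-- The `ZMod 2` boundary of an edge chain at the vertex `v`. -/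
def chainBoundary {n : ℕ} (c : Edge n → ZMod 2) (v : Fin n × Fin n) : ZMod 2 :=
  c (leftE v.1 v.2) + c (rightE v.1 v.2) + c (botE v.1 v.2) + c (topE v.1 v.2)

theorem chainBoundary_add {n : ℕ} (c d : Edge n → ZMod 2) (v : Fin n × Fin n) :
    chainBoundary (c + d) v = chainBoundary c v + chainBoundary d v := by
  simp only [chainBoundary, Pi.add_apply]
  ring

/-- The vertices `v` and `w` bound a `ZMod 2` chain of internal edges satisfying `S`. -/
def ChainLinked {n : ℕ} (S : Edge n → Prop) (v w : Fin n × Fin n) : Prop :=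
  ∃ c : Edge n → ZMod 2, (∀ e, ¬ S e → c e = 0) ∧
    (∀ j, c (Edge.horiz 0 j) = 0) ∧
    (∀ i, c (Edge.vert i 0) = 0) ∧ (∀ i, c (Edge.vert i (Fin.last n)) = 0) ∧
    ∀ u, chainBoundary c u = (if u = v then 1 else 0) + (if u = w then 1 else 0)

namespace ChainLinked

variable {n : ℕ} {S : Edge n → Prop}

theorem refl (v : Fin n × Fin n) : ChainLinked S v v :=
  ⟨0, by simp, by simp, by simp, by simp, fun u => by
    simp [chainBoundary, CharTwo.add_self_eq_zero]⟩

theorem symm {v w : Fin n × Fin n} : ChainLinked S v w → ChainLinked S w v := by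
  rintro ⟨c, hS, h0, hb, ht, hc⟩
  exact ⟨c, hS, h0, hb, ht, fun u => by rw [hc, add_comm]⟩

theorem trans {u v w : Fin n × Fin n} :
    ChainLinked S u v → ChainLinked S v w → ChainLinked S u w := by
  rintro ⟨c, hS, h0, hb, ht, hc⟩ ⟨d, hS', h0', hb', ht', hd⟩
  refine ⟨c + d, fun e he => by simp [hS e he, hS' e he], fun j => by simp [h0, h0'],
    fun i => by simp [hb, hb'], fun i => by simp [ht, ht'], fun x => ?_⟩
  rw [chainBoundary_add, hc, hd, add_assoc, ← add_assoc (if x = v then 1 else 0),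
    CharTwo.add_self_eq_zero, zero_add]

theorem of_horiz {i i' j : Fin n} (h : i.succ = i'.castSucc) (hS : S (Edge.horiz i.succ j)) :
    ChainLinked S (i, j) (i', j) := by
  refine ⟨fun e => if e = Edge.horiz i.succ j then 1 else 0, ?_, ?_, ?_, ?_, ?_⟩
  · intro e he
    refine if_neg ?_
    rintro rfl
    exact he hS
  · intro k
    simp [(Fin.succ_ne_zero i).symm]
  · simp
  · simp
  · rintro ⟨a, b⟩
    have h1 : a.castSucc = i.succ ↔ a = i' := by rw [h, Fin.castSucc_inj]
    simp only [chainBoundary, leftE, rightE, botE, topE, Edge.horiz.injEq, h1, Fin.succ_inj,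
      reduceCtorEq, Prod.mk.injEq, if_false, add_zero]
    exact add_comm _ _

theorem of_vert {i j j' : Fin n} (h : j.succ = j'.castSucc) (hS : S (Edge.vert i j.succ)) :
    ChainLinked S (i, j) (i, j') := by
  refine ⟨fun e => if e = Edge.vert i j.succ then 1 else 0, ?_, ?_, ?_, ?_, ?_⟩
  · intro e he
    refine if_neg ?_
    rintro rfl
    exact he hS
  · simp
  · intro k
    simp [(Fin.succ_ne_zero j).symm]
  · intro k
    simp [h, (Fin.castSucc_ne_last j').symm]
  · rintro ⟨a, b⟩
    have h1 : b.castSucc = j.succ ↔ b = j' := by rw [h, Fin.castSucc_inj]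
    simp only [chainBoundary, leftE, rightE, botE, topE, Edge.vert.injEq, h1, Fin.succ_inj,
      reduceCtorEq, Prod.mk.injEq, if_false, zero_add]
    exact add_comm _ _

theorem of_incident {e : Edge n} (hS : S e) {v w : Fin n × Fin n} (hv : EdgeIncident e v)
    (hw : EdgeIncident e w) : ChainLinked S v w := by
  obtain ⟨a, b⟩ := v
  obtain ⟨a', b'⟩ := w
  cases e with
  | horiz k j =>
    obtain ⟨rfl, h⟩ := hv
    obtain ⟨rfl, h'⟩ := hw
    rcases h with h | h <;> rcases h' with h' | h'
    · obtain rfl := Fin.castSucc_injective n (h.symm.trans h')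
      exact refl _
    · exact (of_horiz (h'.symm.trans h) (h' ▸ hS)).symm
    · exact of_horiz (h.symm.trans h') (h ▸ hS)
    · obtain rfl := Fin.succ_injective n (h.symm.trans h')
      exact refl _
  | vert i k =>
    obtain ⟨rfl, h⟩ := hv
    obtain ⟨rfl, h'⟩ := hw
    rcases h with h | h <;> rcases h' with h' | h'
    · obtain rfl := Fin.castSucc_injective n (h.symm.trans h')
      exact refl _
    · exact (of_vert (h'.symm.trans h) (h' ▸ hS)).symm
    · exact of_vert (h.symm.trans h') (h ▸ hS)
    · obtain rfl := Fin.succ_injective n (h.symm.trans h')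
      exact refl _

theorem of_isChain {p : List (Edge n)} {e f : Edge n} (hp : List.IsChain EdgeAdj p)
    (hS : ∀ e ∈ p, S e) (he : p.head? = some e) (hf : p.getLast? = some f)
    {v w : Fin n × Fin n} (hv : EdgeIncident e v) (hw : EdgeIncident f w) :
    ChainLinked S v w := by
  induction p generalizing e v with
  | nil => simp at he
  | cons a l ih =>
    obtain rfl : a = e := by simpa using he
    have hSa : S a := hS a (by simp)
    cases l with
    | nil =>
      obtain rfl : a = f := by simpa using hf
      exact of_incident hSa hv hw
    | cons b l =>
      rw [List.isChain_cons_cons] at hp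
      obtain ⟨⟨-, u, hau, hbu⟩, hl⟩ := hp
      exact (of_incident hSa hv hau).trans
        (ih hl (fun e h => hS e (List.mem_cons_of_mem _ h)) rfl (by simpa using hf) hbu)

end ChainLinked

/-- The parity of the number of edges of `c` below the face `(x, k)` in its column. -/
def faceParity {n : ℕ} (c : Edge n → ZMod 2) (x k : Fin (n + 1)) : ZMod 2 :=
  Fin.induction (motive := fun _ => ZMod 2) 0 (fun j s => s + c (Edge.horiz x j)) k

section FaceParity

variable {n : ℕ} (c : Edge n → ZMod 2)

theorem faceParity_zero (x : Fin (n + 1)) : faceParity c x 0 = 0 := by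
  simp [faceParity]

theorem faceParity_succ (x : Fin (n + 1)) (j : Fin n) :
    faceParity c x j.succ = faceParity c x j.castSucc + c (Edge.horiz x j) := by
  simp [faceParity]

theorem faceParity_succ_left (hc : ∀ v, chainBoundary c v = 0) (hb : ∀ i, c (Edge.vert i 0) = 0)
    (i : Fin n) (k : Fin (n + 1)) :
    faceParity c i.succ k = faceParity c i.castSucc k + c (Edge.vert i k) := by
  induction k using Fin.induction with
  | zero => simp [faceParity_zero, hb]
  | succ j ih =>
    have h := hc (i, j)
    simp only [chainBoundary, leftE, rightE, botE, topE] at h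
    rw [faceParity_succ, faceParity_succ, ih]
    generalize c (Edge.horiz i.castSucc j) = x at *
    generalize c (Edge.horiz i.succ j) = y at *
    generalize c (Edge.vert i j.castSucc) = z at *
    generalize c (Edge.vert i j.succ) = t at *
    generalize faceParity c i.castSucc j.castSucc = s at *
    clear ih hc hb
    revert x y z t s
    decide

theorem faceParity_top (hc : ∀ v, chainBoundary c v = 0) (hb : ∀ i, c (Edge.vert i 0) = 0)
    (ht : ∀ i, c (Edge.vert i (Fin.last n)) = 0) (x : Fin (n + 1)) :
    faceParity c x (Fin.last n) = faceParity c 0 (Fin.last n) := by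
  induction x using Fin.induction with
  | zero => rfl
  | succ i ih => rw [faceParity_succ_left c hc hb, ht, add_zero, ih]

theorem faceParity_left {j₀ : Fin n} (h : ∀ j, c (Edge.horiz 0 j) = if j = j₀ then 1 else 0)
    (k : Fin (n + 1)) : faceParity c 0 k = if j₀.val < k.val then 1 else 0 := by
  induction k using Fin.induction with
  | zero => simp [faceParity_zero]
  | succ j ih =>
    rw [faceParity_succ, ih, h]
    simp only [Fin.val_castSucc, Fin.val_succ, Fin.ext_iff]
    split_ifs <;> first | omega | simp

end FaceParity

/-- The parity of the face just below (or just left of) an edge. -/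
def edgeParity {n : ℕ} (c : Edge n → ZMod 2) : Edge n → ZMod 2
  | Edge.horiz k j => faceParity c k j.castSucc
  | Edge.vert i k => faceParity c i.castSucc k

theorem eq_of_edgeIncident {n : ℕ} {e : Edge n} {i j : Fin n} (h : EdgeIncident e (i, j)) :
    e = leftE i j ∨ e = rightE i j ∨ e = botE i j ∨ e = topE i j := by
  cases e with
  | horiz k j' =>
    obtain ⟨rfl, rfl | rfl⟩ := h <;> simp [leftE, rightE]
  | vert i' k =>
    obtain ⟨rfl, rfl | rfl⟩ := h <;> simp [botE, topE]

/-- In a state, the horizontal edges at a vertex are both red iff the vertical ones are. -/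
theorem IceRule.horiz_red_iff_vert_red {n : ℕ} {τ : EdgeConfig n} (h : IceRule τ)
    (i j : Fin n) :
    (greenB τ (leftE i j) = false ∧ greenB τ (rightE i j) = false) ↔
      (greenB τ (botE i j) = false ∧ greenB τ (topE i j) = false) := by
  have h := h i j
  simp only [inDegree, greenB, leftE, rightE, botE, topE, greenOrient, Fin.val_castSucc,
    Fin.val_succ] at h ⊢
  generalize τ (Edge.horiz i.castSucc j) = x at *
  generalize τ (Edge.horiz i.succ j) = y at *
  generalize τ (Edge.vert i j.castSucc) = z at *
  generalize τ (Edge.vert i j.succ) = t at *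
  rw [Nat.add_right_comm i.val 1 j.val, ← Nat.add_assoc i.val j.val 1,
    Nat.add_mod (i.val + j.val) 1 2]
  rcases Nat.mod_two_eq_zero_or_one (i.val + j.val) with hp | hp <;>
  · rw [hp]
    revert x y z t
    decide

/-- The face parity of a green cycle is constant along adjacent red edges. -/
theorem edgeParity_eq_of_edgeAdj {n : ℕ} {τ : EdgeConfig n} (hτ : IceRule τ)
    {c : Edge n → ZMod 2} (hS : ∀ e, greenB τ e = false → c e = 0)
    (hc : ∀ v, chainBoundary c v = 0) (hb : ∀ i, c (Edge.vert i 0) = 0) {e f : Edge n}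
    (he : greenB τ e = false) (hf : greenB τ f = false) (h : EdgeAdj e f) :
    edgeParity c e = edgeParity c f := by
  obtain ⟨-, ⟨i, j⟩, hei, hfi⟩ := h
  have hg := hτ.horiz_red_iff_vert_red i j
  have hl := faceParity_succ c i.castSucc j
  have hr := faceParity_succ c i.succ j
  have hbot := faceParity_succ_left c hc hb i j.castSucc
  have htop := faceParity_succ_left c hc hb i j.succ
  have h1 := hS (leftE i j)
  have h2 := hS (rightE i j)
  have h3 := hS (botE i j)
  have h4 := hS (topE i j)
  rcases eq_of_edgeIncident hei with rfl | rfl | rfl | rfl <;>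
    rcases eq_of_edgeIncident hfi with rfl | rfl | rfl | rfl <;>
    simp only [leftE, rightE, botE, topE, edgeParity] at * <;>
    grind

/-- A horizontal green bridge excludes a vertical red bridge. -/
theorem not_vertRedBridge_of_horizGreenBridge {n : ℕ} {τ : EdgeConfig n} (hτ : IceRule τ)
    (hG : HorizGreenBridge τ) : ¬ VertRedBridge τ := by
  rintro ⟨q, ⟨-, -, hq, hred⟩, ⟨i₀, hq0⟩, ⟨i₁, hq1⟩⟩
  obtain ⟨p, ⟨-, -, hp, hgreen⟩, ⟨j₀, hp0⟩, ⟨j₁, hp1⟩⟩ := hG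
  obtain ⟨m, rfl⟩ : ∃ m, n = m + 1 := ⟨n - 1, by have := j₀.isLt; omega⟩
  have hmem0 := hgreen _ (List.mem_of_head? hp0)
  have hmem1 := hgreen _ (List.mem_of_getLast? hp1)
  obtain ⟨d, hS, h0, hb, ht, hd⟩ := ChainLinked.of_isChain (S := fun e => greenB τ e = true)
    (v := (0, j₀)) (w := (Fin.last m, j₁)) hp hgreen hp0 hp1
    ⟨rfl, Or.inl rfl⟩ ⟨rfl, Or.inr rfl⟩
  let c : Edge (m + 1) → ZMod 2 := fun e => d e +
    ((if e = Edge.horiz 0 j₀ then 1 else 0) +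
      (if e = Edge.horiz (Fin.last (m + 1)) j₁ then 1 else 0))
  have hcS : ∀ e, greenB τ e = false → c e = 0 := by
    intro e he
    have h1 : e ≠ Edge.horiz 0 j₀ := by rintro rfl; simp [he] at hmem0
    have h2 : e ≠ Edge.horiz (Fin.last (m + 1)) j₁ := by rintro rfl; simp [he] at hmem1
    simp [c, h1, h2, hS e (by simp [he])]
  have hcb : ∀ i, c (Edge.vert i 0) = 0 := fun i => by simp [c, hb]
  have hct : ∀ i, c (Edge.vert i (Fin.last _)) = 0 := fun i => by simp [c, ht]
  have hcl : ∀ j, c (Edge.horiz 0 j) = if j = j₀ then 1 else 0 := fun j => by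
    simp [c, h0, (Fin.last_pos (n := m)).ne]
  have hcc : ∀ v, chainBoundary c v = 0 := by
    rintro ⟨a, b⟩
    have h1 : a.succ = Fin.last (m + 1) ↔ a = Fin.last m := by
      rw [← Fin.succ_last, Fin.succ_inj]
    have h2 : chainBoundary c (a, b) = chainBoundary d (a, b) +
        ((if (a, b) = (0, j₀) then 1 else 0) + (if (a, b) = (Fin.last m, j₁) then 1 else 0)) := by
      simp only [c, chainBoundary, leftE, rightE, botE, topE, Edge.horiz.injEq, reduceCtorEq,
        Prod.mk.injEq, if_false, add_zero, h1, Fin.castSucc_eq_zero_iff, Fin.succ_ne_zero,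
        Fin.castSucc_ne_last, false_and, zero_add]
      ring
    rw [h2, hd, CharTwo.add_self_eq_zero]
  have key : ∀ (l : List (Edge (m + 1))) (e f : Edge (m + 1)), List.IsChain EdgeAdj l →
      (∀ e ∈ l, greenB τ e = false) → l.head? = some e → l.getLast? = some f →
      edgeParity c e = edgeParity c f := by
    intro l
    induction l with
    | nil => simp
    | cons a l ih =>
      intro e f hl hr he hf
      obtain rfl : a = e := by simpa using he
      cases l with
      | nil =>
        obtain rfl : a = f := by simpa using hf
        rfl
      | cons b l =>
        rw [List.isChain_cons_cons] at hl
        exact (edgeParity_eq_of_edgeAdj hτ hcS hcc hcb (hr a (by simp)) (hr b (by simp)) hl.1).trans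
          (ih b f hl.2 (fun e h => hr e (List.mem_cons_of_mem _ h)) rfl (by simpa using hf))
  have h := key q _ _ hq hred hq0 hq1
  simp only [edgeParity, faceParity_zero] at h
  rw [faceParity_top c hcc hcb hct, faceParity_left c hcl, if_pos (by exact j₀.isLt)] at h
  exact one_ne_zero h

/-- a green cross and a red cross cannot coexist:
`C_G ∩ C_R = ∅`. -/
theorem cross_disjoint (n : ℕ) (hn : 1 ≤ n) : CG n ∩ CR n = ∅ := by
  rw [Set.eq_empty_iff_forall_notMem]
  rintro τ ⟨⟨hτ, hG, -⟩, -, -, hR⟩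
  exact not_vertRedBridge_of_horizGreenBridge hτ hG hR
end

section
/- In any state τ ∈ Ω, for every vertex v of Λ_n, if exactly two of the four edges incident to v are green, then those two green edges are rotationally adjacent around v (they meet at a 90° corner); in particular, the configuration in which the two horizontal edges at v are green and the two vertical edges at v are red (or vice versa) is impossible, since it would force all four edges at v to point inwards or all to point outwards, violating the ice rule. -/
open Finset

/-- Around a vertex, `τ_G` orients opposite edges oppositely (both in or both out), with
the horizontal pair and the vertical pair differing. -/
theorem greenOrient_around_vertex {n : ℕ} (i j : Fin n) :
    greenOrient (rightE i j) = !greenOrient (leftE i j) ∧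
      greenOrient (botE i j) = !greenOrient (leftE i j) ∧
      greenOrient (topE i j) = greenOrient (leftE i j) := by
  rcases Nat.mod_two_eq_zero_or_one (i.val + j.val) with h | h <;>
    simp only [greenOrient, leftE, rightE, botE, topE, Fin.val_castSucc, Fin.val_succ] <;>
    simp [h, show (i.val + 1 + j.val) % 2 = 1 - (i.val + j.val) % 2 by omega,
      show (i.val + (j.val + 1)) % 2 = 1 - (i.val + j.val) % 2 by omega]

/-- if exactly two of the four edges incident to a vertex are
green, then the two green edges are rotationally adjacent; the configuration
with two green horizontal edges and two red vertical edges (or vice versa)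
is impossible. -/
theorem two_green_edges_rotationally_adjacent (n : ℕ) (hn : 1 ≤ n)
    (τ : EdgeConfig n) (hτ : τ ∈ OmegaSet n) (i j : Fin n)
    (h2 : greenCountAt τ i j = 2) :
    ¬ (IsGreen τ (leftE i j) ∧ IsGreen τ (rightE i j)) ∧
      ¬ (IsGreen τ (botE i j) ∧ IsGreen τ (topE i j)) := by
  obtain ⟨hr, hb, ht⟩ := greenOrient_around_vertex i j
  have hice : inDegree τ i j = 2 := hτ i j
  simp only [inDegree] at hice
  simp only [greenCountAt, greenB, hr, hb, ht] at h2
  simp only [IsGreen, hr, hb, ht]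
  generalize greenOrient (leftE i j) = g at *
  generalize τ (leftE i j) = l at *
  generalize τ (rightE i j) = r at *
  generalize τ (botE i j) = b at *
  generalize τ (topE i j) = t at *
  clear hr hb ht
  revert g l r b t
  decide
end

section
/- If a state τ ∈ Ω has a vertical fault line, then τ has no horizontal monochromatic bridge (neither a green horizontal bridge nor a red horizontal bridge); symmetrically, a horizontal fault line precludes any vertical monochromatic bridge. Consequently C_FL is disjoint from both C_G and C_R. -/
open Finset

namespace List

theorem IsChain.reflTransGen_of_head?_of_getLast? {α : Type*} {R : α → α → Prop}
    {p : List α} {a b : α} (h : p.IsChain R) (ha : p.head? = some a)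
    (hb : p.getLast? = some b) : Relation.ReflTransGen R a b := by
  have hne : p ≠ [] := by rintro rfl; simp at ha
  rw [head?_eq_some_head hne, Option.some.injEq] at ha
  rw [getLast?_eq_some_getLast hne, Option.some.injEq] at hb
  subst ha hb
  exact relationReflTransGen_of_exists_isChain p h hne

end List

/-- A path of `L_τ`-edges is a mod `2` chain of `L_τ`-edges whose boundary is the sum of the
two ends of the path. -/
theorem exists_chain_of_reflTransGen {n : ℕ} {τ : EdgeConfig n} {u v : LVertex n}
    (h : Relation.ReflTransGen (LStep τ) u v) :
    ∃ c : LEdge n → ZMod 2, (∀ e, c e ≠ 0 → lTau τ e = true) ∧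
      ∀ φ : LVertex n → ZMod 2,
        ∑ e, c e * (φ (lEdgeEnds e).1 + φ (lEdgeEnds e).2) = φ u + φ v := by
  induction h with
  | refl => exact ⟨0, by simp, fun φ => by simp [CharTwo.add_self_eq_zero]⟩
  | @tail v w _ hvw ih =>
    obtain ⟨c, hc, hφ⟩ := ih
    obtain ⟨e, he, hτ⟩ := hvw
    refine ⟨c + Pi.single e 1, fun f hf => ?_, fun φ => ?_⟩
    · by_cases hfe : f = e
      · rwa [hfe]
      · exact hc f (by simpa [hfe] using hf)
    · have hs : φ (lEdgeEnds e).1 + φ (lEdgeEnds e).2 = φ v + φ w := by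
        rcases he with he | he <;> rw [he]
        exact add_comm _ _
      simp only [Pi.add_apply, add_mul, sum_add_distrib, hφ, Pi.single_apply, ite_mul, one_mul,
        zero_mul, sum_ite_eq', mem_univ, if_true, hs]
      linear_combination CharTwo.add_self_eq_zero (φ v)

/-- The mod `2` number of edges of the chain `c` in row `j` to the left of column `k`. -/
def rowCount {n : ℕ} (c : LEdge n → ZMod 2) (k : ℕ) (j : Fin n) : ZMod 2 :=
  ∑ e : LEdge n, c e * if e.1.2 = j ∧ e.1.1.val < k then 1 else 0

theorem rowCount_zero {n : ℕ} (c : LEdge n → ZMod 2) (j : Fin n) : rowCount c 0 j = 0 := by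
  simp [rowCount]

theorem sum_mul_ite_eq {n : ℕ} (c : LEdge n → ZMod 2) (f : LEdge n) :
    ∑ e, c e * (if e = f then 1 else 0) = c f := by
  simp

theorem rowCount_succ {n : ℕ} (c : LEdge n → ZMod 2) (i j : Fin n) :
    rowCount c (i + 1) j = rowCount c i j + c ((i, j), true) + c ((i, j), false) := by
  rw [← sum_mul_ite_eq c ((i, j), true), ← sum_mul_ite_eq c ((i, j), false), rowCount, rowCount,
    ← sum_add_distrib, ← sum_add_distrib]
  refine sum_congr rfl fun ⟨⟨a, b⟩, d⟩ _ => ?_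
  rw [← mul_add, ← mul_add]
  congr 1
  cases d <;> simp only [Prod.mk.injEq, Fin.ext_iff, reduceCtorEq] <;> grind

/-- The side of the chain `c` on which an edge of `Λ_n` lies. -/
def chainSide {n : ℕ} (c : LEdge n → ZMod 2) : Edge n → ZMod 2
  | Edge.horiz k j => rowCount c k j
  | Edge.vert i ⟨0, _⟩ => rowCount c i ⟨0, i.pos⟩ + c ((i, ⟨0, i.pos⟩), true)
  | Edge.vert i ⟨k + 1, hk⟩ =>
      rowCount c i ⟨k, by omega⟩ + c ((i, ⟨k, by omega⟩), false)

section

variable {n : ℕ} {c : LEdge n → ZMod 2} {u v : LVertex n}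

theorem chainSide_horiz_zero (c : LEdge n → ZMod 2) (j : Fin n) :
    chainSide c (Edge.horiz 0 j) = 0 := rowCount_zero c j

theorem chainSide_horiz_last
    (hc : ∀ φ : LVertex n → ZMod 2,
      ∑ e, c e * (φ (lEdgeEnds e).1 + φ (lEdgeEnds e).2) = φ u + φ v)
    (huv : u.2 = Fin.last n ∧ v.2 = 0 ∨ u.2 = 0 ∧ v.2 = Fin.last n) (j : Fin n) :
    chainSide c (Edge.horiz (Fin.last n) j) = 1 := by
  have h := hc fun w => if j.val < w.2.val then 1 else 0
  have hr : ((if j.val < u.2.val then 1 else 0) + if j.val < v.2.val then 1 else 0 : ZMod 2) = 1 := by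
    rcases huv with ⟨hu, hv⟩ | ⟨hu, hv⟩ <;> simp [hu, hv]
  rw [← hr, ← h]
  refine sum_congr rfl fun ⟨⟨a, b⟩, d⟩ _ => ?_
  have h2 : (1 + 1 : ZMod 2) = 0 := rfl
  congr 1
  cases d <;> simp only [lEdgeEnds, Fin.ext_iff, Fin.val_last, Fin.val_succ, Fin.val_castSucc] <;>
    grind

theorem chainSide_rightE (i j : Fin n) :
    chainSide c (rightE i j) =
      chainSide c (leftE i j) + c ((i, j), true) + c ((i, j), false) :=
  rowCount_succ c i j

theorem chainSide_topE (i j : Fin n) :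
    chainSide c (topE i j) = chainSide c (leftE i j) + c ((i, j), false) := rfl

theorem chainSide_botE
    (hc : ∀ φ : LVertex n → ZMod 2,
      ∑ e, c e * (φ (lEdgeEnds e).1 + φ (lEdgeEnds e).2) = φ u + φ v)
    (huv : u.2 = Fin.last n ∧ v.2 = 0 ∨ u.2 = 0 ∧ v.2 = Fin.last n) (i j : Fin n) :
    chainSide c (botE i j) = chainSide c (leftE i j) + c ((i, j), true) := by
  obtain ⟨_ | k, hk⟩ := j
  · rfl
  change rowCount c i ⟨k, _⟩ + c ((i, ⟨k, _⟩), false) =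
    rowCount c i ⟨k + 1, hk⟩ + c ((i, ⟨k + 1, hk⟩), true)
  have h := hc fun w => if w.2.val = k + 1 ∧ w.1.val ≤ i.val then 1 else 0
  have hr : ((if u.2.val = k + 1 ∧ u.1.val ≤ i.val then 1 else 0) +
      if v.2.val = k + 1 ∧ v.1.val ≤ i.val then 1 else 0 : ZMod 2) = 0 := by
    have h0 : n ≠ k + 1 := by omega
    rcases huv with ⟨hu, hv⟩ | ⟨hu, hv⟩ <;> simp [hu, hv, h0]
  rw [← sub_eq_zero, CharTwo.sub_eq_add, ← hr, ← h,
    ← sum_mul_ite_eq c ((i, ⟨k, _⟩), false), ← sum_mul_ite_eq c ((i, ⟨k + 1, hk⟩), true),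
    rowCount, rowCount, ← sum_add_distrib, ← sum_add_distrib, ← sum_add_distrib]
  refine sum_congr rfl fun ⟨⟨a, b⟩, d⟩ _ => ?_
  rw [← mul_add, ← mul_add, ← mul_add]
  congr 1
  cases d <;> simp only [lEdgeEnds, Prod.mk.injEq, Fin.ext_iff, Fin.val_succ, Fin.val_castSucc,
    reduceCtorEq] <;> grind

end

theorem edgeIncident_iff {n : ℕ} {e : Edge n} {i j : Fin n} :
    EdgeIncident e (i, j) ↔ e = leftE i j ∨ e = rightE i j ∨ e = botE i j ∨ e = topE i j := by
  cases e <;> simp [EdgeIncident, leftE, rightE, botE, topE] <;> tauto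

/-- `side` labels the edges of `Λ_n` so that adjacent edges of the same colour in `τ` have the
same label. -/
def RespectsColour {n : ℕ} (τ : EdgeConfig n) (side : Edge n → ZMod 2) : Prop :=
  ∀ e f, EdgeAdj e f → greenB τ e = greenB τ f → side e = side f

theorem exists_side_of_reflTransGen {n : ℕ} {τ : EdgeConfig n} {u v : LVertex n}
    (h : Relation.ReflTransGen (LStep τ) u v)
    (huv : u.2 = Fin.last n ∧ v.2 = 0 ∨ u.2 = 0 ∧ v.2 = Fin.last n) :
    ∃ side : Edge n → ZMod 2, RespectsColour τ side ∧
      (∀ j, side (Edge.horiz 0 j) = 0) ∧ ∀ j, side (Edge.horiz (Fin.last n) j) = 1 := by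
  obtain ⟨c, hτ, hc⟩ := exists_chain_of_reflTransGen h
  refine ⟨chainSide c, ?_, chainSide_horiz_zero c, chainSide_horiz_last hc huv⟩
  rintro e f ⟨-, ⟨i, j⟩, he, hf⟩ hef
  have hR := chainSide_rightE (c := c) i j
  have hT := chainSide_topE (c := c) i j
  have hB := chainSide_botE hc huv i j
  have hNE := hτ ((i, j), true)
  have hNW := hτ ((i, j), false)
  have h2 : (1 + 1 : ZMod 2) = 0 := rfl
  have h01 : ∀ x : ZMod 2, x = 0 ∨ x = 1 := by decide
  simp only [lTau, Bool.and_eq_true, beq_iff_eq, Bool.not_eq_true', beq_eq_false_iff_ne] at hNE hNW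
  rw [edgeIncident_iff] at he hf
  rcases h01 (c ((i, j), true)) with h1 | h1 <;> rcases h01 (c ((i, j), false)) with h3 | h3 <;>
    simp only [h1, h3, add_zero, ne_eq, one_ne_zero, not_true_eq_false, not_false_eq_true,
      false_imp_iff, true_imp_iff] at hR hT hB hNE hNW <;> grind

/-- Reflection of the edges of `Λ_n` in the diagonal. -/
def Edge.transpose {n : ℕ} : Edge n → Edge n
  | Edge.horiz k j => Edge.vert j k
  | Edge.vert i k => Edge.horiz k i

/-- Reflection of a configuration in the diagonal, followed by total edge reversal; it preserves
the colours. -/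
def transposeConfig {n : ℕ} (τ : EdgeConfig n) : EdgeConfig n := fun e => !(τ e.transpose)

section

variable {n : ℕ} {τ : EdgeConfig n}

theorem greenB_transposeConfig (e : Edge n) :
    greenB (transposeConfig τ) e = greenB τ e.transpose := by
  have hG : greenOrient e.transpose = !(greenOrient e) := by
    cases e <;> simp only [Edge.transpose, greenOrient] <;> grind
  rw [greenB, greenB, hG, transposeConfig]
  cases τ e.transpose <;> cases greenOrient e <;> rfl

theorem EdgeAdj.transpose {e f : Edge n} (h : EdgeAdj e f) :
    EdgeAdj e.transpose f.transpose := by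
  obtain ⟨hne, ⟨i, j⟩, he, hf⟩ := h
  refine ⟨fun h => hne ?_, (j, i), ?_, ?_⟩
  · cases e <;> cases f <;> simp_all [Edge.transpose]
  · cases e <;> exact he
  · cases f <;> exact hf

theorem lTau_transposeConfig (i j : Fin n) (d : Bool) :
    lTau (transposeConfig τ) ((j, i), d) = lTau τ ((i, j), d) := by
  have hl : greenB τ (leftE j i).transpose = greenB τ (botE i j) := rfl
  have hr : greenB τ (rightE j i).transpose = greenB τ (topE i j) := rfl
  have hb : greenB τ (botE j i).transpose = greenB τ (leftE i j) := rfl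
  have ht : greenB τ (topE j i).transpose = greenB τ (rightE i j) := rfl
  cases d <;> simp only [lTau, greenB_transposeConfig, hl, hr, hb, ht] <;>
    generalize greenB τ (leftE i j) = a <;> generalize greenB τ (rightE i j) = b <;>
    generalize greenB τ (botE i j) = c <;> generalize greenB τ (topE i j) = d <;>
    revert a b c d <;> decide

theorem LStep.transpose {u v : LVertex n} (h : LStep τ u v) :
    LStep (transposeConfig τ) u.swap v.swap := by
  obtain ⟨⟨⟨i, j⟩, d⟩, he, hτ⟩ := h
  refine ⟨((j, i), d), ?_, (lTau_transposeConfig i j d).trans hτ⟩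
  obtain ⟨u₁, u₂⟩ := u
  obtain ⟨v₁, v₂⟩ := v
  cases d <;> simp only [StepOnEdge, lEdgeEnds, Prod.swap, Prod.mk.injEq] at he ⊢ <;> tauto

theorem HasVertFaultLine.exists_side (h : HasVertFaultLine τ) :
    ∃ side : Edge n → ZMod 2, RespectsColour τ side ∧
      (∀ j, side (Edge.horiz 0 j) = 0) ∧ ∀ j, side (Edge.horiz (Fin.last n) j) = 1 := by
  obtain ⟨p, -, -, hp, ⟨u, hu, hu'⟩, v, hv, hv'⟩ := h
  exact exists_side_of_reflTransGen (hp.reflTransGen_of_head?_of_getLast? hu hv)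
    (.inl ⟨hu', hv'⟩)

theorem HasHorizFaultLine.exists_side (h : HasHorizFaultLine τ) :
    ∃ side : Edge n → ZMod 2, RespectsColour τ side ∧
      (∀ i, side (Edge.vert i 0) = 0) ∧ ∀ i, side (Edge.vert i (Fin.last n)) = 1 := by
  obtain ⟨p, -, -, hp, ⟨u, hu, hu'⟩, v, hv, hv'⟩ := h
  obtain ⟨side, hs, h0, h1⟩ := exists_side_of_reflTransGen
    ((hp.reflTransGen_of_head?_of_getLast? hu hv).lift Prod.swap fun _ _ => LStep.transpose)
    (.inr ⟨hu', hv'⟩)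
  refine ⟨side ∘ Edge.transpose, fun e f hef hg => hs _ _ hef.transpose ?_, h0, h1⟩
  rw [greenB_transposeConfig, greenB_transposeConfig]
  cases e <;> cases f <;> exact hg

theorem MonoPath.side_eq {side : Edge n → ZMod 2} (hs : RespectsColour τ side) {g : Bool}
    {p : List (Edge n)} (hp : MonoPath τ g p) {e f : Edge n} (he : p.head? = some e)
    (hf : p.getLast? = some f) : side e = side f := by
  obtain ⟨-, -, hch, hg⟩ := hp
  have hch' : p.IsChain fun a b => side a = side b :=
    hch.imp_of_mem_imp fun a b ha hb hab => hs a b hab ((hg a ha).trans (hg b hb).symm)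
  have h := hch'.reflTransGen_of_head?_of_getLast? he hf
  clear hf
  induction h with
  | refl => rfl
  | tail _ h ih => exact ih.trans h

theorem HasVertFaultLine.not_isHorizBridge (h : HasVertFaultLine τ) (g : Bool)
    (p : List (Edge n)) : ¬ IsHorizBridge τ g p := by
  rintro ⟨hp, ⟨j, hj⟩, k, hk⟩
  obtain ⟨side, hs, h0, h1⟩ := h.exists_side
  exact zero_ne_one ((h0 j).symm.trans ((hp.side_eq hs hj hk).trans (h1 k)))

theorem HasHorizFaultLine.not_isVertBridge (h : HasHorizFaultLine τ) (g : Bool)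
    (p : List (Edge n)) : ¬ IsVertBridge τ g p := by
  rintro ⟨hp, ⟨i, hi⟩, k, hk⟩
  obtain ⟨side, hs, h0, h1⟩ := h.exists_side
  exact one_ne_zero ((h1 i).symm.trans ((hp.side_eq hs hi hk).trans (h0 k)))

end

/-- a vertical fault line precludes any horizontal
monochromatic bridge, a horizontal fault line precludes any vertical
monochromatic bridge; consequently `C_FL` is disjoint from `C_G` and `C_R`. -/
theorem fault_line_precludes_bridge (n : ℕ) (hn : 1 ≤ n) :
    (∀ τ : EdgeConfig n, τ ∈ OmegaSet n →
      (HasVertFaultLine τ → ¬ HorizGreenBridge τ ∧ ¬ HorizRedBridge τ) ∧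
      (HasHorizFaultLine τ → ¬ VertGreenBridge τ ∧ ¬ VertRedBridge τ)) ∧
    CFL n ∩ CG n = ∅ ∧ CFL n ∩ CR n = ∅ := by
  refine ⟨fun τ _ => ⟨fun h => ⟨fun ⟨p, hp⟩ => h.not_isHorizBridge _ p hp,
    fun ⟨p, hp⟩ => h.not_isHorizBridge _ p hp⟩, fun h => ⟨fun ⟨p, hp⟩ => h.not_isVertBridge _ p hp,
    fun ⟨p, hp⟩ => h.not_isVertBridge _ p hp⟩⟩, ?_, ?_⟩ <;>
  · rw [Set.eq_empty_iff_forall_notMem]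
    rintro τ ⟨⟨-, h | h⟩, -, ⟨p, hp⟩, q, hq⟩
    · exact h.not_isVertBridge _ q hq
    · exact h.not_isHorizBridge _ p hp
end

section
/- If a state τ ∈ Ω has no green horizontal bridge and no red horizontal bridge, then τ has a vertical fault line. -/
open Finset

open Relation

/-- A reachable point is reached along a self-avoiding chain of reachable points. -/
theorem exists_nodup_chain_of_reflTransGen {α : Type*} {r : α → α → Prop} {a b : α}
    (h : ReflTransGen r a b) :
    ∃ p : List α, p ≠ [] ∧ p.Nodup ∧ List.IsChain r p ∧ p.head? = some a ∧
      p.getLast? = some b ∧ ∀ x ∈ p, ReflTransGen r a x := by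
  induction h using ReflTransGen.head_induction_on with
  | refl => exact ⟨[b], by simp, by simp, by simp, by simp, by simp, by simp [ReflTransGen.refl]⟩
  | @head a c hac _ ih =>
    obtain ⟨p, hne, hnd, hch, hhd, hlast, hreach⟩ := ih
    have hreach' : ∀ x ∈ p, ReflTransGen r a x := fun x hx => (hreach x hx).head hac
    by_cases ha : a ∈ p
    · obtain ⟨l₁, l₂, rfl⟩ := List.append_of_mem ha
      refine ⟨a :: l₂, by simp, hnd.of_append_right, hch.right_of_append, rfl, ?_, ?_⟩
      · simpa [List.getLast?_append] using hlast
      · exact fun x hx => hreach' x (List.mem_append_right _ hx)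
    · obtain ⟨q, rfl⟩ : ∃ q, p = c :: q := by
        cases p with
        | nil => exact absurd rfl hne
        | cons d q => exact ⟨q, by simpa using hhd⟩
      refine ⟨a :: c :: q, by simp, List.nodup_cons.2 ⟨ha, hnd⟩,
        List.isChain_cons_cons.2 ⟨hac, hch⟩, rfl, by simpa using hlast, ?_⟩
      intro x hx
      rcases List.mem_cons.1 hx with rfl | hx
      · exact ReflTransGen.refl
      · exact hreach' x hx

/-- Adjacency of edges of the same colour. -/
def SameColourAdj {n : ℕ} (τ : EdgeConfig n) (e f : Edge n) : Prop :=
  EdgeAdj e f ∧ greenB τ e = greenB τ f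

theorem greenB_eq_of_reflTransGen {n : ℕ} {τ : EdgeConfig n} {e f : Edge n}
    (h : ReflTransGen (SameColourAdj τ) e f) : greenB τ f = greenB τ e := by
  induction h with
  | refl => rfl
  | tail _ h ih => exact h.2.symm.trans ih

theorem exists_isHorizBridge_of_reflTransGen {n : ℕ} {τ : EdgeConfig n} {j k : Fin n}
    (h : ReflTransGen (SameColourAdj τ) (Edge.horiz 0 j) (Edge.horiz (Fin.last n) k)) :
    ∃ p, IsHorizBridge τ (greenB τ (Edge.horiz 0 j)) p := by
  obtain ⟨p, hne, hnd, hch, hhd, hlast, hreach⟩ := exists_nodup_chain_of_reflTransGen h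
  exact ⟨p, ⟨hne, hnd, hch.imp fun _ _ h => h.1,
    fun e he => greenB_eq_of_reflTransGen (hreach e he)⟩, ⟨j, hhd⟩, ⟨k, hlast⟩⟩

/-- The edges connected to the left boundary by a monochromatic path. -/
def LeftConnected {n : ℕ} (τ : EdgeConfig n) (e : Edge n) : Prop :=
  ∃ j, ReflTransGen (SameColourAdj τ) (Edge.horiz 0 j) e

theorem LeftConnected.of_incident {n : ℕ} {τ : EdgeConfig n} {e f : Edge n} {v : Fin n × Fin n}
    (he : EdgeIncident e v) (hf : EdgeIncident f v) (hef : greenB τ e = greenB τ f)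
    (h : LeftConnected τ e) : LeftConnected τ f := by
  by_cases hne : e = f
  · exact hne ▸ h
  · obtain ⟨j, hj⟩ := h
    exact ⟨j, hj.tail ⟨⟨hne, v, he, hf⟩, hef⟩⟩

/-- The `L_n`-vertices connected to the top boundary by a path in `L_τ`. -/
def TopConnected {n : ℕ} (τ : EdgeConfig n) (u : LVertex n) : Prop :=
  ∃ i, ReflTransGen (LStep τ) (i, Fin.last n) u

theorem LStep.symm {n : ℕ} {τ : EdgeConfig n} {u v : LVertex n} (h : LStep τ u v) :
    LStep τ v u := by
  obtain ⟨e, he, ht⟩ := h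
  exact ⟨e, he.symm, ht⟩

theorem LStep.topConnected_iff {n : ℕ} {τ : EdgeConfig n} {u v : LVertex n} (h : LStep τ u v) :
    TopConnected τ u ↔ TopConnected τ v :=
  ⟨fun ⟨i, hi⟩ => ⟨i, hi.tail h⟩, fun ⟨i, hi⟩ => ⟨i, hi.tail h.symm⟩⟩

theorem TopConnected.hasVertFaultLine {n : ℕ} {τ : EdgeConfig n} {i : Fin (n + 1)}
    (h : TopConnected τ (i, 0)) : HasVertFaultLine τ := by
  obtain ⟨k, hk⟩ := h
  obtain ⟨p, hne, hnd, hch, hhd, hlast, -⟩ := exists_nodup_chain_of_reflTransGen hk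
  exact ⟨p, hne, hnd, hch, ⟨_, hhd, rfl⟩, ⟨_, hlast, rfl⟩⟩

/-- Under the ice rule every vertex is monochromatic or has one horizontal and one vertical
edge of each colour. -/
theorem IceRule.colours {n : ℕ} {τ : EdgeConfig n} (hτ : IceRule τ) (i j : Fin n) :
    (greenB τ (leftE i j) = greenB τ (rightE i j) ∧
      greenB τ (leftE i j) = greenB τ (botE i j) ∧
      greenB τ (leftE i j) = greenB τ (topE i j)) ∨
    (greenB τ (leftE i j) = !greenB τ (rightE i j) ∧
      greenB τ (botE i j) = !greenB τ (topE i j)) := by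
  have h := hτ i j
  have hL : greenOrient (leftE i j) = ((i.val + j.val) % 2 == 0) := rfl
  have hR : greenOrient (rightE i j) = !((i.val + j.val) % 2 == 0) := by
    have : greenOrient (rightE i j) = ((i.val + 1 + j.val) % 2 == 0) := rfl
    rw [this, Bool.eq_iff_iff]; simp; omega
  have hB : greenOrient (botE i j) = !((i.val + j.val) % 2 == 0) := by
    have : greenOrient (botE i j) = ((i.val + j.val) % 2 == 1) := rfl
    rw [this, Bool.eq_iff_iff]; simp
  have hT : greenOrient (topE i j) = ((i.val + j.val) % 2 == 0) := by
    have : greenOrient (topE i j) = ((i.val + (j.val + 1)) % 2 == 1) := rfl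
    rw [this, Bool.eq_iff_iff]; simp; omega
  simp only [inDegree] at h
  simp only [greenB, hL, hR, hB, hT]
  generalize ((i.val + j.val) % 2 == 0) = b
  revert h
  generalize τ (leftE i j) = x, τ (rightE i j) = y, τ (botE i j) = z, τ (topE i j) = w
  revert b x y z w
  decide

/-- Modulo 2, a sum of differences of a function along a path is the difference of the ends. -/
theorem sum_castSucc_add_succ_zmod_two {n : ℕ} (f : Fin (n + 1) → ZMod 2) :
    ∑ i : Fin n, (f i.castSucc + f i.succ) = f 0 + f (Fin.last n) := by
  have h := (Fin.sum_univ_castSucc f).symm.trans (Fin.sum_univ_succ f)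
  rw [Finset.sum_add_distrib]
  linear_combination h + CharTwo.add_self_eq_zero (∑ i : Fin n, f i.succ) -
    CharTwo.add_self_eq_zero (f (Fin.last n))

/-- The local identity at a vertex: a colour-constant `s` on the four edges, and `c` constant
along the edges of `L_τ`, pair to zero modulo 2. -/
theorem IceRule.local_sum_eq_zero {n : ℕ} {τ : EdgeConfig n} (hτ : IceRule τ)
    {s : Edge n → ZMod 2} {c : LVertex n → ZMod 2}
    (hs : ∀ v e f, EdgeIncident e v → EdgeIncident f v → greenB τ e = greenB τ f → s e = s f)
    (hc : ∀ u v, LStep τ u v → c u = c v) (i j : Fin n) :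
    s (leftE i j) * (c (i.castSucc, j.castSucc) + c (i.castSucc, j.succ)) +
      s (rightE i j) * (c (i.succ, j.castSucc) + c (i.succ, j.succ)) +
      (s (botE i j) * (c (i.castSucc, j.castSucc) + c (i.succ, j.castSucc)) +
      s (topE i j) * (c (i.castSucc, j.succ) + c (i.succ, j.succ))) = 0 := by
  have iL : EdgeIncident (leftE i j) (i, j) := ⟨rfl, Or.inl rfl⟩
  have iR : EdgeIncident (rightE i j) (i, j) := ⟨rfl, Or.inr rfl⟩
  have iB : EdgeIncident (botE i j) (i, j) := ⟨rfl, Or.inl rfl⟩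
  have iT : EdgeIncident (topE i j) (i, j) := ⟨rfl, Or.inr rfl⟩
  have h2 : (2 : ZMod 2) = 0 := rfl
  rcases hτ.colours i j with ⟨hR, hB, hT⟩ | ⟨hLR, hBT⟩
  · rw [← hs _ _ _ iL iR hR, ← hs _ _ _ iL iB hB, ← hs _ _ _ iL iT hT]
    linear_combination (s (leftE i j) * (c (i.castSucc, j.castSucc) + c (i.castSucc, j.succ) +
      c (i.succ, j.castSucc) + c (i.succ, j.succ))) * h2
  · by_cases hLT : greenB τ (leftE i j) = greenB τ (topE i j)
    · have hRB : greenB τ (rightE i j) = greenB τ (botE i j) := by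
        rw [hBT, ← hLT, hLR, Bool.not_not]
      have hstep : c (i.castSucc, j.castSucc) = c (i.succ, j.succ) :=
        hc _ _ ⟨((i, j), true), Or.inl rfl, by simp [lTau, hRB, ← hLT, hLR]⟩
      rw [← hs _ _ _ iL iT hLT, ← hs _ _ _ iR iB hRB, hstep]
      linear_combination ((s (leftE i j)) * (c (i.succ, j.succ) + c (i.castSucc, j.succ)) +
        s (rightE i j) * (c (i.succ, j.succ) + c (i.succ, j.castSucc))) * h2
    · have hLB : greenB τ (leftE i j) = greenB τ (botE i j) := by
        rw [hBT]; exact Bool.eq_not_of_ne hLT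
      have hRT : greenB τ (rightE i j) = greenB τ (topE i j) := by
        rw [← Bool.not_inj_iff, ← hLR, hLB, hBT]
      have hstep : c (i.succ, j.castSucc) = c (i.castSucc, j.succ) :=
        hc _ _ ⟨((i, j), false), Or.inl rfl, by simp [lTau, ← hRT, ← hLB, hLR]⟩
      rw [← hs _ _ _ iL iB hLB, ← hs _ _ _ iR iT hRT, hstep]
      linear_combination ((s (leftE i j)) * (c (i.castSucc, j.castSucc) + c (i.castSucc, j.succ)) +
        s (rightE i j) * (c (i.castSucc, j.succ) + c (i.succ, j.succ))) * h2

/-- Summing the local identity over all vertices leaves only the boundary terms. -/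
theorem IceRule.boundary_sum_eq_zero {n : ℕ} {τ : EdgeConfig n} (hτ : IceRule τ)
    {s : Edge n → ZMod 2} {c : LVertex n → ZMod 2}
    (hs : ∀ v e f, EdgeIncident e v → EdgeIncident f v → greenB τ e = greenB τ f → s e = s f)
    (hc : ∀ u v, LStep τ u v → c u = c v) :
    ∑ j : Fin n, (s (Edge.horiz 0 j) * (c (0, j.castSucc) + c (0, j.succ)) +
        s (Edge.horiz (Fin.last n) j) * (c (Fin.last n, j.castSucc) + c (Fin.last n, j.succ))) +
      ∑ i : Fin n, (s (Edge.vert i 0) * (c (i.castSucc, 0) + c (i.succ, 0)) +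
        s (Edge.vert i (Fin.last n)) *
          (c (i.castSucc, Fin.last n) + c (i.succ, Fin.last n))) = 0 := by
  have h : ∑ i : Fin n, ∑ j : Fin n, (_ : ZMod 2) = 0 :=
    Finset.sum_eq_zero fun i _ => Finset.sum_eq_zero fun j _ => hτ.local_sum_eq_zero hs hc i j
  simp only [Finset.sum_add_distrib (f := fun j : Fin n => s (leftE _ j) * _ + _)] at h
  rw [Finset.sum_add_distrib, Finset.sum_comm] at h
  rw [← h]
  congr 1
  · exact Finset.sum_congr rfl fun j _ => (sum_castSucc_add_succ_zmod_two
      fun k => s (Edge.horiz k j) * (c (k, j.castSucc) + c (k, j.succ))).symm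
  · exact Finset.sum_congr rfl fun i _ => (sum_castSucc_add_succ_zmod_two
      fun k => s (Edge.vert i k) * (c (i.castSucc, k) + c (i.succ, k))).symm

/-- if there is neither a green nor a red horizontal bridge,
then there is a vertical fault line. -/
theorem no_horiz_bridge_vert_fault_line (n : ℕ) (hn : 1 ≤ n)
    (τ : EdgeConfig n) (hτ : τ ∈ OmegaSet n)
    (hg : ¬ HorizGreenBridge τ) (hr : ¬ HorizRedBridge τ) :
    HasVertFaultLine τ := by
  classical
  by_contra hno
  have hright (j : Fin n) : ¬ LeftConnected τ (Edge.horiz (Fin.last n) j) := by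
    rintro ⟨k, hk⟩
    have hb := exists_isHorizBridge_of_reflTransGen hk
    cases hcol : greenB τ (Edge.horiz 0 k) <;> rw [hcol] at hb
    · exact hr hb
    · exact hg hb
  have hleft (j : Fin n) : LeftConnected τ (Edge.horiz 0 j) := ⟨j, ReflTransGen.refl⟩
  have htop (i : Fin (n + 1)) : TopConnected τ (i, Fin.last n) := ⟨i, ReflTransGen.refl⟩
  have hbot (i : Fin (n + 1)) : ¬ TopConnected τ (i, 0) := fun h => hno h.hasVertFaultLine
  have h := IceRule.boundary_sum_eq_zero hτ
    (s := fun e => if LeftConnected τ e then 1 else 0)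
    (c := fun u => if TopConnected τ u then 1 else 0)
    (fun v e f he hf hef => if_congr
      ⟨LeftConnected.of_incident he hf hef, LeftConnected.of_incident hf he hef.symm⟩ rfl rfl)
    (fun u v huv => if_congr huv.topConnected_iff rfl rfl)
  simp only [hright, hleft, htop, hbot, if_true, if_false, one_mul, zero_mul, add_zero,
    CharTwo.add_self_eq_zero, mul_zero, Finset.sum_const_zero] at h
  rw [sum_castSucc_add_succ_zmod_two fun k => if TopConnected τ (0, k) then (1 : ZMod 2) else 0]
    at h
  simp [htop, hbot] at h
end
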